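/- arXiv:1604.06823 — 2 statements merged into one kernel-verified Lean document; each statement's English description precedes it below -/
import Mathlib

section
/- Let p be a real polynomial in n variables with total degree at most 2d. Then, in the extended reals, inf {p(x) : x ∈ ℝⁿ} = sup {μ ∈ ℝ : the degree-2d homogenization of p − μ satisfies (p − μ)^h(y) ≥ 0 for all y ∈ ℝ^{n+1}}. -/
/-- The degree-`d` homogenization of a polynomial `p` in the variables `x₁, …, x_n`:
`p^h = ∑_α p_α · x₀^(d - |α|) · x^α`, a polynomial in the `n + 1` variables
`(x₀, x₁, …, x_n)` (variable `0` is the homogenizing variable, variable `i.succ` is `x_i`). -/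
noncomputable def homogenize {n : ℕ} (d : ℕ) (p : MvPolynomial (Fin n) ℝ) :
    MvPolynomial (Fin (n + 1)) ℝ :=
  ∑ α ∈ p.support,
    MvPolynomial.C (MvPolynomial.coeff α p) *
      MvPolynomial.X (0 : Fin (n + 1)) ^ (d - ∑ i, α i) *
      ∏ i : Fin n, MvPolynomial.X i.succ ^ α i

theorem eval_cons_homogenize {n : ℕ} {d : ℕ} {q : MvPolynomial (Fin n) ℝ}
    (hq : q.totalDegree ≤ d) {t : ℝ} (ht : t ≠ 0) (x : Fin n → ℝ) :
    MvPolynomial.eval (Fin.cons t x : Fin (n + 1) → ℝ) (homogenize d q) =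
      t ^ d * MvPolynomial.eval (fun i => x i / t) q := by
  rw [homogenize, map_sum, MvPolynomial.eval_eq', Finset.mul_sum]
  refine Finset.sum_congr rfl fun α hα => ?_
  have hα' : ∑ i, α i ≤ d := by
    have h := (MvPolynomial.le_totalDegree hα).trans hq
    rwa [Finsupp.sum_fintype _ _ fun _ => rfl] at h
  simp only [map_mul, map_pow, map_prod, MvPolynomial.eval_C, MvPolynomial.eval_X,
    Fin.cons_zero, Fin.cons_succ, div_pow, Finset.prod_div_distrib, Finset.prod_pow_eq_pow_sum]
  rw [← pow_sub_mul_pow t hα']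
  field_simp

/-- The homogenization of even degree is nonnegative exactly when the polynomial is. -/
theorem homogenize_nonneg_iff {n d : ℕ} {q : MvPolynomial (Fin n) ℝ}
    (hq : q.totalDegree ≤ 2 * d) :
    (∀ y : Fin (n + 1) → ℝ, 0 ≤ MvPolynomial.eval y (homogenize (2 * d) q)) ↔
      ∀ x : Fin n → ℝ, 0 ≤ MvPolynomial.eval x q := by
  constructor
  · intro h x
    simpa [eval_cons_homogenize hq one_ne_zero] using h (Fin.cons 1 x)
  · intro h y
    have hcont : Continuous fun t : ℝ =>
        MvPolynomial.eval (Fin.cons t (Fin.tail y) : Fin (n + 1) → ℝ) (homogenize (2 * d) q) :=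
      (MvPolynomial.continuous_eval _).comp
        (Continuous.finCons (A := fun _ => ℝ) continuous_id continuous_const)
    have hclosed := isClosed_le (continuous_const (y := (0 : ℝ))) hcont
    have hsub : ({0}ᶜ : Set ℝ) ⊆ {t | (0 : ℝ) ≤ MvPolynomial.eval
        (Fin.cons t (Fin.tail y) : Fin (n + 1) → ℝ) (homogenize (2 * d) q)} := by
      intro t ht
      rw [Set.mem_ofPred_eq, eval_cons_homogenize hq ht, pow_mul]
      exact mul_nonneg (by positivity) (h _)
    have hy : y 0 ∈ closure ({0}ᶜ : Set ℝ) := dense_compl_singleton 0 (y 0)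
    simpa only [Set.mem_ofPred_eq, Fin.cons_self_tail] using hclosed.closure_subset_iff.2 hsub hy

/-- for `p` of total degree at most `2d`, in the extended reals,
`inf {p(x) : x ∈ ℝⁿ} = sup {μ : (p - μ)^h ≥ 0 on ℝ^(n+1)}`. -/
theorem inf_eq_sup_psd (n d : ℕ)
    (p : MvPolynomial (Fin n) ℝ) (hdeg : p.totalDegree ≤ 2 * d) :
    sInf {z : EReal | ∃ x : Fin n → ℝ, z = ((MvPolynomial.eval x p : ℝ) : EReal)} =
      sSup {z : EReal | ∃ μ : ℝ, z = ((μ : ℝ) : EReal) ∧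
        ∀ y : Fin (n + 1) → ℝ,
          0 ≤ MvPolynomial.eval y (homogenize (2 * d) (p - MvPolynomial.C μ))} := by
  have key (μ : ℝ) : (∀ y : Fin (n + 1) → ℝ,
      0 ≤ MvPolynomial.eval y (homogenize (2 * d) (p - MvPolynomial.C μ))) ↔
        ∀ x : Fin n → ℝ, μ ≤ MvPolynomial.eval x p := by
    rw [homogenize_nonneg_iff ((MvPolynomial.totalDegree_sub_C_le p μ).trans hdeg)]
    simp
  simp only [key]
  refine le_antisymm ?_ ?_
  · refine EReal.ge_of_forall_gt_iff_ge.1 fun μ hμ => ?_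
    refine le_sSup ⟨μ, rfl, fun x => ?_⟩
    exact EReal.coe_le_coe_iff.1 (hμ.le.trans (sInf_le ⟨x, rfl⟩))
  · refine sSup_le ?_
    rintro _ ⟨μ, rfl, hμ⟩
    refine le_sInf ?_
    rintro _ ⟨x, rfl⟩
    exact EReal.coe_le_coe_iff.2 (hμ x)
end

section
/- Let p₀,…,p_m be real polynomials in n variables of total degree at most d, and for i = 0,…,m let T_i be a symmetric tensor of dimension n+1 and order d representing p_i; let T_e be a symmetric tensor with ⟨T_e, M_d(y)⟩ = (y₀)^d for all y ∈ ℝ^{n+1}. Define in the extended reals: z₊ := inf {p₀(x) : x ∈ ℝⁿ, x ≥ 0, p_i(x) ≤ 0 for i = 1,…,m}; z_CP := inf {⟨T₀, X⟩ : X ∈ convexHull{M_d(y) : y ∈ ℝ^{n+1}, y ≥ 0}, ⟨T_i, X⟩ ≤ 0 for i = 1,…,m, ⟨T_e, X⟩ = 1}; z_CD := sup {μ ∈ ℝ : ∃ u ∈ ℝᵐ, u ≥ 0, such that ⟨T₀, M_d(y)⟩ + ∑_{i=1}^m u_i ⟨T_i, M_d(y)⟩ − μ (y₀)^d ≥ 0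 for all y ∈ ℝ^{n+1} with y ≥ 0}; z_semi := sup_{u ∈ ℝᵐ, u ≥ 0} inf_{x ∈ ℝⁿ, x ≥ 0} (p₀(x) + ∑_{i=1}^m u_i p_i(x)); z_{LD,+} := sup_{u ∈ ℝᵐ, u ≥ 0, v ∈ ℝⁿ, v ≥ 0} inf_{x ∈ ℝⁿ} (p₀(x) + ∑_{i=1}^m u_i p_i(x) − ∑_{k=1}^n v_k x_k). Then z_{LD,+} ≤ z_semi, z_semi = z_CD, and z_CD ≤ z_CP ≤ z₊. -/
/-- A tensor of dimension `n` and order `d` is symmetric if its entries are invariant under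
permutations of its indices. -/
def IsSymmTensor {n d : ℕ} (T : (Fin d → Fin n) → ℝ) : Prop :=
  ∀ (σ : Equiv.Perm (Fin d)) (f : Fin d → Fin n), T (f ∘ σ) = T f

/-- The tensor inner product `⟨S, T⟩ = ∑ f, S f * T f`. -/
noncomputable def tenIP {n d : ℕ} (S T : (Fin d → Fin n) → ℝ) : ℝ :=
  ∑ f : Fin d → Fin n, S f * T f

/-- `M_d(x)`, the symmetric tensor with entries `M_d(x)(f) = ∏ j, x (f j)`. -/
def tenM (n d : ℕ) (x : Fin n → ℝ) : (Fin d → Fin n) → ℝ := fun f => ∏ j : Fin d, x (f j)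

/-- A symmetric tensor `T` of dimension `n + 1` and order `d` represents the polynomial `p`
(of total degree at most `d`) if `⟨T, M_d(y)⟩ = p^h(y)` for all `y ∈ ℝ^(n+1)`. -/
def Represents {n : ℕ} (d : ℕ) (T : (Fin d → Fin (n + 1)) → ℝ)
    (p : MvPolynomial (Fin n) ℝ) : Prop :=
  ∀ y : Fin (n + 1) → ℝ,
    tenIP T (tenM (n + 1) d y) = MvPolynomial.eval y (homogenize d p)

lemma eval_cons_one_homogenize {n : ℕ} (d : ℕ) (p : MvPolynomial (Fin n) ℝ) (x : Fin n → ℝ) :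
    MvPolynomial.eval (Fin.cons 1 x) (homogenize d p) = MvPolynomial.eval x p := by
  rw [MvPolynomial.eval_eq' x, homogenize, map_sum]
  simp

lemma Represents.tenIP_cons_one {n d : ℕ} {T : (Fin d → Fin (n + 1)) → ℝ}
    {p : MvPolynomial (Fin n) ℝ} (h : Represents d T p) (x : Fin n → ℝ) :
    tenIP T (tenM (n + 1) d (Fin.cons 1 x)) = MvPolynomial.eval x p := by
  rw [h, eval_cons_one_homogenize]

lemma tenM_smul {n d : ℕ} (c : ℝ) (y : Fin n → ℝ) :
    tenM n d (c • y) = c ^ d • tenM n d y := by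
  ext f
  simp [tenM, Finset.prod_mul_distrib]

lemma tenIP_add_right {n d : ℕ} (S X Y : (Fin d → Fin n) → ℝ) :
    tenIP S (X + Y) = tenIP S X + tenIP S Y := by
  simp [tenIP, mul_add, Finset.sum_add_distrib]

lemma tenIP_smul_right {n d : ℕ} (S : (Fin d → Fin n) → ℝ) (c : ℝ) (X : (Fin d → Fin n) → ℝ) :
    tenIP S (c • X) = c * tenIP S X := by
  simp only [tenIP, Finset.mul_sum, Pi.smul_apply, smul_eq_mul]
  exact Finset.sum_congr rfl fun f _ => by ring

lemma continuous_tenIP_tenM {n d : ℕ} (S : (Fin d → Fin n) → ℝ) :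
    Continuous fun y => tenIP S (tenM n d y) := by
  unfold tenIP tenM
  fun_prop

/-- The Lagrangian `⟨T₀, X⟩ + ∑ uᵢ ⟨Tᵢ, X⟩ - μ ⟨Tₑ, X⟩` of the completely positive program. -/
noncomputable def tenLagrangian {n d m : ℕ} (T : Fin (m + 1) → (Fin d → Fin n) → ℝ)
    (Te : (Fin d → Fin n) → ℝ) (u : Fin m → ℝ) (μ : ℝ) (X : (Fin d → Fin n) → ℝ) : ℝ :=
  tenIP (T 0) X + (∑ i : Fin m, u i * tenIP (T i.succ) X) - μ * tenIP Te X

section tenLagrangian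

variable {n d m : ℕ} (T : Fin (m + 1) → (Fin d → Fin n) → ℝ) (Te : (Fin d → Fin n) → ℝ)
  (u : Fin m → ℝ) (μ : ℝ)

lemma isLinearMap_tenLagrangian : IsLinearMap ℝ (tenLagrangian T Te u μ) where
  map_add X Y := by
    simp only [tenLagrangian, tenIP_add_right, mul_add, Finset.sum_add_distrib]
    ring
  map_smul c X := by
    simp only [tenLagrangian, tenIP_smul_right, smul_eq_mul, mul_sub, mul_add, Finset.mul_sum,
      mul_left_comm c]

lemma continuous_tenLagrangian_tenM :
    Continuous fun y => tenLagrangian T Te u μ (tenM n d y) := by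
  have h := fun S : (Fin d → Fin n) → ℝ => continuous_tenIP_tenM S
  unfold tenLagrangian
  fun_prop

end tenLagrangian

lemma tenLagrangian_tenM_cons_one {n d m : ℕ} {p : Fin (m + 1) → MvPolynomial (Fin n) ℝ}
    {T : Fin (m + 1) → (Fin d → Fin (n + 1)) → ℝ} (hT : ∀ i, Represents d (T i) (p i))
    {Te : (Fin d → Fin (n + 1)) → ℝ}
    (hTe : ∀ y : Fin (n + 1) → ℝ, tenIP Te (tenM (n + 1) d y) = (y 0) ^ d)
    (u : Fin m → ℝ) (μ : ℝ) (x : Fin n → ℝ) :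
    tenLagrangian T Te u μ (tenM (n + 1) d (Fin.cons 1 x)) =
      MvPolynomial.eval x (p 0) + (∑ i : Fin m, u i * MvPolynomial.eval x (p i.succ)) - μ := by
  simp [tenLagrangian, (hT _).tenIP_cons_one, hTe]

/-- The Lagrangian is nonnegative at all `M_d(y)`, `y ≥ 0`, once it is so on the slice `y₀ = 1`:
by homogeneity this gives the points with `y₀ > 0`, and by continuity those with `y₀ = 0`. -/
lemma tenLagrangian_tenM_nonneg {n d m : ℕ} {T : Fin (m + 1) → (Fin d → Fin (n + 1)) → ℝ}
    {Te : (Fin d → Fin (n + 1)) → ℝ} {u : Fin m → ℝ} {μ : ℝ}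
    (h : ∀ x : Fin n → ℝ, (∀ j, 0 ≤ x j) →
      0 ≤ tenLagrangian T Te u μ (tenM (n + 1) d (Fin.cons 1 x)))
    {y : Fin (n + 1) → ℝ} (hy : ∀ j, 0 ≤ y j) :
    0 ≤ tenLagrangian T Te u μ (tenM (n + 1) d y) := by
  have pos : ∀ z : Fin (n + 1) → ℝ, (∀ j, 0 ≤ z j) → 0 < z 0 →
      0 ≤ tenLagrangian T Te u μ (tenM (n + 1) d z) := by
    intro z hz hz0
    have hz_eq : z = z 0 • (Fin.cons 1 fun j => z j.succ / z 0 : Fin (n + 1) → ℝ) := by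
      ext j
      refine Fin.cases ?_ (fun j => ?_) j
      · simp
      · simp [mul_div_cancel₀ _ hz0.ne']
    rw [hz_eq, tenM_smul, (isLinearMap_tenLagrangian T Te u μ).map_smul]
    exact mul_nonneg (pow_nonneg hz0.le d) (h _ fun j => div_nonneg (hz _) hz0.le)
  have hcont : Continuous fun ε : ℝ =>
      tenLagrangian T Te u μ (tenM (n + 1) d (y + fun _ => ε)) :=
    (continuous_tenLagrangian_tenM T Te u μ).comp (by fun_prop)
  have hlim := (hcont.tendsto 0).mono_left (nhdsWithin_le_nhds (s := Set.Ioi 0))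
  have hzero : (y + fun _ => (0 : ℝ)) = y := by ext j; simp
  rw [hzero] at hlim
  refine ge_of_tendsto hlim ?_
  filter_upwards [self_mem_nhdsWithin] with ε hε
  have hε : 0 < ε := hε
  exact pos _ (fun j => add_nonneg (hy j) hε.le) (add_pos_of_nonneg_of_pos (hy 0) hε)

/-- with `z₊`, `z_CP`, `z_CD`, `z_semi`, `z_{LD,+}` as in the CP tensor
relaxation of a POP with nonnegative variables,
`z_{LD,+} ≤ z_semi`, `z_semi = z_CD`, and `z_CD ≤ z_CP ≤ z₊` in the extended reals. -/
theorem semiLagrangian_eq_cp_dual_le_cp_le_pop (n d m : ℕ)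
    (p : Fin (m + 1) → MvPolynomial (Fin n) ℝ)
    (hdeg : ∀ i, (p i).totalDegree ≤ d)
    (T : Fin (m + 1) → (Fin d → Fin (n + 1)) → ℝ)
    (hTsymm : ∀ i, IsSymmTensor (T i))
    (hTrep : ∀ i, Represents d (T i) (p i))
    (Te : (Fin d → Fin (n + 1)) → ℝ)
    (hTesymm : IsSymmTensor Te)
    (hTerep : ∀ y : Fin (n + 1) → ℝ, tenIP Te (tenM (n + 1) d y) = (y 0) ^ d)
    (zP zCP zCD zSemi zLDP : EReal)
    (hzP : zP = sInf {w : EReal | ∃ x : Fin n → ℝ, (∀ j, 0 ≤ x j) ∧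
      (∀ i : Fin m, MvPolynomial.eval x (p i.succ) ≤ 0) ∧
      w = ((MvPolynomial.eval x (p 0) : ℝ) : EReal)})
    (hzCP : zCP = sInf {w : EReal | ∃ X : (Fin d → Fin (n + 1)) → ℝ,
      X ∈ convexHull ℝ {S : (Fin d → Fin (n + 1)) → ℝ |
        ∃ y : Fin (n + 1) → ℝ, (∀ j, 0 ≤ y j) ∧ S = tenM (n + 1) d y} ∧
      (∀ i : Fin m, tenIP (T i.succ) X ≤ 0) ∧
      tenIP Te X = 1 ∧
      w = ((tenIP (T 0) X : ℝ) : EReal)})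
    (hzCD : zCD = sSup {w : EReal | ∃ μ : ℝ, w = ((μ : ℝ) : EReal) ∧
      ∃ u : Fin m → ℝ, (∀ i, 0 ≤ u i) ∧
        ∀ y : Fin (n + 1) → ℝ, (∀ j, 0 ≤ y j) →
          0 ≤ tenIP (T 0) (tenM (n + 1) d y) +
              (∑ i : Fin m, u i * tenIP (T i.succ) (tenM (n + 1) d y)) -
              μ * (y 0) ^ d})
    (hzSemi : zSemi = ⨆ (u : Fin m → ℝ) (_ : ∀ i, 0 ≤ u i),
      ⨅ (x : Fin n → ℝ) (_ : ∀ j, 0 ≤ x j),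
        ((MvPolynomial.eval x (p 0) +
          ∑ i : Fin m, u i * MvPolynomial.eval x (p i.succ) : ℝ) : EReal))
    (hzLDP : zLDP = ⨆ (u : Fin m → ℝ) (_ : ∀ i, 0 ≤ u i)
        (v : Fin n → ℝ) (_ : ∀ k, 0 ≤ v k),
      ⨅ (x : Fin n → ℝ),
        ((MvPolynomial.eval x (p 0) +
          (∑ i : Fin m, u i * MvPolynomial.eval x (p i.succ)) -
          ∑ k : Fin n, v k * x k : ℝ) : EReal)) :
    zLDP ≤ zSemi ∧ zSemi = zCD ∧ zCD ≤ zCP ∧ zCP ≤ zP := by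
  have cons_nonneg : ∀ x : Fin n → ℝ, (∀ j, 0 ≤ x j) →
      ∀ j, 0 ≤ (Fin.cons 1 x : Fin (n + 1) → ℝ) j := fun x hx j =>
    Fin.cases (by simp) (fun j => by simpa using hx j) j
  have lag_eq : ∀ (u : Fin m → ℝ) (μ : ℝ) (y : Fin (n + 1) → ℝ),
      tenIP (T 0) (tenM (n + 1) d y) +
        (∑ i : Fin m, u i * tenIP (T i.succ) (tenM (n + 1) d y)) - μ * (y 0) ^ d =
      tenLagrangian T Te u μ (tenM (n + 1) d y) := fun u μ y => by
    rw [tenLagrangian, hTerep]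
  simp only [lag_eq] at hzCD
  subst hzP hzCP hzCD hzSemi hzLDP
  refine ⟨?_, le_antisymm ?_ ?_, ?_, ?_⟩
  · refine iSup₂_mono fun u _ => iSup₂_le fun v hv => le_iInf₂ fun x hx => iInf_le_of_le x ?_
    exact EReal.coe_le_coe_iff.2
      (sub_le_self _ (Finset.sum_nonneg fun k _ => mul_nonneg (hv k) (hx k)))
  · refine iSup₂_le fun u hu => EReal.ge_of_forall_gt_iff_ge.1 fun μ hμ => ?_
    refine le_sSup ⟨μ, rfl, u, hu, fun y hy => tenLagrangian_tenM_nonneg (fun x hx => ?_) hy⟩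
    rw [tenLagrangian_tenM_cons_one hTrep hTerep]
    exact sub_nonneg.2 (EReal.coe_le_coe_iff.1 (hμ.le.trans (iInf₂_le x hx)))
  · refine sSup_le ?_
    rintro - ⟨μ, rfl, u, hu, h⟩
    refine le_iSup₂_of_le u hu (le_iInf₂ fun x hx => EReal.coe_le_coe_iff.2 ?_)
    have := h _ (cons_nonneg x hx)
    rw [tenLagrangian_tenM_cons_one hTrep hTerep] at this
    exact sub_nonneg.1 this
  · refine sSup_le ?_
    rintro - ⟨μ, rfl, u, hu, h⟩
    refine le_sInf ?_
    rintro - ⟨X, hX, hXT, hXe, rfl⟩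
    have hnonneg : X ∈ {X | 0 ≤ tenLagrangian T Te u μ X} := by
      refine convexHull_min ?_
        (convex_halfSpace_ge (isLinearMap_tenLagrangian T Te u μ) 0) hX
      rintro - ⟨y, hy, rfl⟩
      exact h y hy
    rw [Set.mem_ofPred_eq, tenLagrangian, hXe] at hnonneg
    have hsum : ∑ i : Fin m, u i * tenIP (T i.succ) X ≤ 0 :=
      Finset.sum_nonpos fun i _ => mul_nonpos_of_nonneg_of_nonpos (hu i) (hXT i)
    exact EReal.coe_le_coe_iff.2 (by linarith)
  · refine le_sInf ?_
    rintro - ⟨x, hx, hxp, rfl⟩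
    refine sInf_le ⟨tenM (n + 1) d (Fin.cons 1 x),
      subset_convexHull ℝ _ ⟨_, cons_nonneg x hx, rfl⟩, fun i => ?_, ?_, ?_⟩
    · rw [(hTrep _).tenIP_cons_one]
      exact hxp i
    · simp [hTerep]
    · rw [(hTrep _).tenIP_cons_one]
end
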